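/- arXiv:2210.02594 — 5 statements merged into one kernel-verified Lean document; each statement's English description precedes it below -/
import Mathlib

section
/- Let P ∈ ℕ₊, let G := {0, 1/P, 2/P, …, 1}, and let M₁, M₂ ∈ ℕ₊. Set d := ⌊ln(M₁+M₂)/ln((P+1)/P)⌋ + 1. Let c⁽¹⁾₁,…,c⁽¹⁾_{M₁} and c⁽²⁾₁,…,c⁽²⁾_{M₂} be vectors in G^n with n > d. For each subset J ⊆ {1,…,n}, define the vector u_J ∈ ℝ^{M₁+M₂} by u_J := ((Π_{j∈J} c⁽¹⁾_m(j))_{m=1}^{M₁}, (Π_{j∈J} c⁽²⁾_m(j))_{m=1}^{M₂}), with the empty product equal to 1. Then u_{\{1,…,n\}} lies in the ℝ-linear span of { u_J : J ⊆ {1,…,n}, |J| ≤ d }. -/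
open Finset

/-- Greedy covering: if the values `f m j` are at most `P`, one can pick a target `g j` for each
coordinate so that each coordinate of `S` eliminates a fraction `1 / (P + 1)` of the remaining
points. -/
lemma exists_card_filter_forall_ne_mul_pow_le {ι α : Type*} [Fintype ι] [DecidableEq α] (P : ℕ)
    (f : ι → α → ℕ) (hf : ∀ m j, f m j ≤ P) (S : Finset α) :
    ∃ g : α → ℕ, #{m | ∀ j ∈ S, f m j ≠ g j} * (P + 1) ^ #S ≤ Fintype.card ι * P ^ #S := by
  induction S using Finset.induction_on with
  | empty => exact ⟨0, by simp [Finset.card_univ]⟩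
  | insert a S ha ih =>
    obtain ⟨g, hg⟩ := ih
    set T : Finset ι := {m | ∀ j ∈ S, f m j ≠ g j} with hT
    obtain ⟨i, hi⟩ : ∃ i, #T ≤ (P + 1) * #{m ∈ T | f m a = i} := by
      by_contra! h
      have hsum : #T = ∑ i ∈ range (P + 1), #{m ∈ T | f m a = i} :=
        card_eq_sum_card_fiberwise fun m _ => by simpa [Nat.lt_succ_iff] using hf m a
      have hlt : ∑ i ∈ range (P + 1), (P + 1) * #{m ∈ T | f m a = i}
          < ∑ _i ∈ range (P + 1), #T :=
        sum_lt_sum_of_nonempty (by simp) fun i _ => h i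
      rw [← mul_sum, ← hsum, sum_const, card_range, smul_eq_mul] at hlt
      exact lt_irrefl _ hlt
    refine ⟨Function.update g a i, ?_⟩
    have hfilter : ({m | ∀ j ∈ insert a S, f m j ≠ Function.update g a i j} : Finset ι)
        = {m ∈ T | ¬ f m a = i} := by
      ext m
      have hS : (∀ j ∈ S, f m j ≠ Function.update g a i j) ↔ ∀ j ∈ S, f m j ≠ g j :=
        forall₂_congr fun j hj => by
          rw [Function.update_of_ne (ne_of_mem_of_not_mem hj ha)]
      simp only [hT, mem_filter, mem_univ, true_and, forall_mem_insert, Function.update_self, hS]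
      exact and_comm
    have hsplit := card_filter_add_card_filter_not (s := T) (fun m => f m a = i)
    have hstep : #{m ∈ T | ¬ f m a = i} * (P + 1) ≤ #T * P := by nlinarith
    rw [hfilter, card_insert_of_notMem ha, pow_succ', pow_succ']
    calc #{m ∈ T | ¬ f m a = i} * ((P + 1) * (P + 1) ^ #S)
        = (#{m ∈ T | ¬ f m a = i} * (P + 1)) * (P + 1) ^ #S := by ring
      _ ≤ (#T * P) * (P + 1) ^ #S := by gcongr
      _ = (#T * (P + 1) ^ #S) * P := by ring
      _ ≤ (Fintype.card ι * P ^ #S) * P := by gcongr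
      _ = Fintype.card ι * (P * P ^ #S) := by ring

lemma exists_forall_exists_eq_of_card_mul_pow_lt {ι α : Type*} [Fintype ι] [DecidableEq α] (P : ℕ)
    (f : ι → α → ℕ) (hf : ∀ m j, f m j ≤ P) (S : Finset α)
    (hS : Fintype.card ι * P ^ #S < (P + 1) ^ #S) :
    ∃ g : α → ℕ, ∀ m, ∃ j ∈ S, f m j = g j := by
  obtain ⟨g, hg⟩ := exists_card_filter_forall_ne_mul_pow_le P f hf S
  refine ⟨g, fun m => ?_⟩
  by_contra! hm
  exact (hg.trans_lt hS).not_ge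
    (Nat.le_mul_of_pos_left _ (card_pos.2 ⟨m, mem_filter.2 ⟨mem_univ m, hm⟩⟩))

/-- If the points `c m` can be hit on every coordinate set of size `d` by a single target vector,
then every product vector lies in the span of those of degree at most `d`. -/
lemma prod_mem_span_of_exists_hit {ι α : Type*} [DecidableEq α] (c : ι → α → ℝ) (d : ℕ)
    (hit : ∀ S : Finset α, #S = d → ∃ g : α → ℝ, ∀ m, ∃ j ∈ S, c m j = g j) (J : Finset α) :
    (fun m => ∏ j ∈ J, c m j) ∈ Submodule.span ℝ
      ((fun (J : Finset α) m => ∏ j ∈ J, c m j) '' {J : Finset α | #J ≤ d}) := by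
  induction J using Finset.strongInduction with
  | H J ih =>
    rcases le_or_gt (#J) d with hJ | hJ
    · exact Submodule.subset_span ⟨J, hJ, rfl⟩
    obtain ⟨S, hSJ, hS⟩ := exists_subset_card_eq hJ.le
    obtain ⟨g, hg⟩ := hit S hS
    have key : (fun m => ∏ j ∈ J, c m j)
        = -∑ t ∈ S.ssubsets, (∏ j ∈ S \ t, -g j) • fun m => ∏ j ∈ t ∪ (J \ S), c m j := by
      ext m
      obtain ⟨j, hj, hcg⟩ := hg m
      have hzero : ∏ j ∈ S, (c m j + -g j) = 0 :=
        prod_eq_zero hj (by rw [hcg, add_neg_cancel])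
      rw [prod_add, ← sum_erase_add _ _ (mem_powerset_self S), sdiff_self, bot_eq_empty, prod_empty,
        mul_one] at hzero
      have hprod : ∀ t ⊆ S, ∏ j ∈ t ∪ (J \ S), c m j
          = (∏ j ∈ t, c m j) * ∏ j ∈ J \ S, c m j := fun t ht =>
        prod_union (disjoint_sdiff.mono_left ht)
      have hsum : ∑ t ∈ S.ssubsets, (∏ j ∈ S \ t, -g j) * ∏ j ∈ t ∪ (J \ S), c m j
          = (∑ t ∈ S.ssubsets, (∏ j ∈ t, c m j) * ∏ j ∈ S \ t, -g j)
            * ∏ j ∈ J \ S, c m j := by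
        rw [sum_mul]
        refine sum_congr rfl fun t ht => ?_
        rw [hprod t (mem_ssubsets.1 ht).subset]
        ring
      have hJprod := hprod S Subset.rfl
      rw [union_sdiff_of_subset hSJ] at hJprod
      simp only [Pi.neg_apply, Finset.sum_apply, Pi.smul_apply, smul_eq_mul]
      rw [hsum, hJprod, ← neg_mul]
      congr 1
      exact eq_neg_of_add_eq_zero_right hzero
    rw [key]
    refine Submodule.neg_mem _ (Submodule.sum_mem _ fun t ht => Submodule.smul_mem _ _ (ih _ ?_))
    rw [mem_ssubsets] at ht
    obtain ⟨x, hxS, hxt⟩ := exists_of_ssubset ht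
    refine (ssubset_iff_of_subset (union_subset (ht.subset.trans hSJ) sdiff_subset)).2
      ⟨x, hSJ hxS, by simp [hxS, hxt]⟩

lemma mul_pow_lt_succ_pow_of_log_div_log_lt {M P d : ℕ} (hM : 0 < M) (hP : 0 < P)
    (h : Real.log M / Real.log (((P : ℝ) + 1) / P) < d) : M * P ^ d < (P + 1) ^ d := by
  have hP' : (0 : ℝ) < P := by exact_mod_cast hP
  have hM' : (0 : ℝ) < M := by exact_mod_cast hM
  have hlog : 0 < Real.log (((P : ℝ) + 1) / P) :=
    Real.log_pos (by rw [one_lt_div hP']; linarith)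
  rw [div_lt_iff₀ hlog, ← Real.log_pow, Real.log_lt_log_iff hM' (by positivity), div_pow,
    lt_div_iff₀ (by positivity)] at h
  exact_mod_cast h

/-- high-degree moments of integral mixtures are spanned by low-degree
moments.  Let `G = {0, 1/P, …, 1}` and `d = ⌊ln(M₁+M₂)/ln((P+1)/P)⌋ + 1`.  For vectors
`c⁽¹⁾_m, c⁽²⁾_m ∈ G^n` with `n > d`, the concatenated full-product vector `u_{{1,…,n}}`
lies in the linear span of the vectors `u_J` over subsets `J` with `|J| ≤ d`. -/
theorem statement10 (P : ℕ) (hP : 0 < P)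
    (M₁ M₂ : ℕ) (hM₁ : 0 < M₁) (hM₂ : 0 < M₂)
    (d : ℕ)
    (hd : d = Nat.floor (Real.log ((M₁ : ℝ) + M₂) / Real.log (((P : ℝ) + 1) / P)) + 1)
    (n : ℕ) (hn : d < n)
    (c₁ : Fin M₁ → Fin n → ℝ) (c₂ : Fin M₂ → Fin n → ℝ)
    (hc₁ : ∀ m j, ∃ i : ℕ, i ≤ P ∧ c₁ m j = (i : ℝ) / P)
    (hc₂ : ∀ m j, ∃ i : ℕ, i ≤ P ∧ c₂ m j = (i : ℝ) / P) :
    (Fin.append (fun m => ∏ j, c₁ m j) (fun m => ∏ j, c₂ m j) : Fin (M₁ + M₂) → ℝ)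
      ∈ Submodule.span ℝ
          ((fun J : Finset (Fin n) =>
              (Fin.append (fun m => ∏ j ∈ J, c₁ m j) (fun m => ∏ j ∈ J, c₂ m j) :
                Fin (M₁ + M₂) → ℝ)) ''
            {J : Finset (Fin n) | J.card ≤ d}) := by
  have hc : ∀ m j, ∃ i : ℕ, i ≤ P ∧
      (Fin.append c₁ c₂ : Fin (M₁ + M₂) → Fin n → ℝ) m j = (i : ℝ) / P := by
    intro m j
    induction m using Fin.addCases with
    | left m => simpa using hc₁ m j
    | right m => simpa using hc₂ m j
  choose f hfP hf using hc
  have happend : ∀ J : Finset (Fin n),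
      (Fin.append (fun m => ∏ j ∈ J, c₁ m j) (fun m => ∏ j ∈ J, c₂ m j) : Fin (M₁ + M₂) → ℝ)
        = fun m => ∏ j ∈ J, (Fin.append c₁ c₂ : Fin (M₁ + M₂) → Fin n → ℝ) m j := by
    intro J
    ext m
    induction m using Fin.addCases with
    | left m => simp
    | right m => simp
  have hpow : (M₁ + M₂) * P ^ d < (P + 1) ^ d := by
    refine mul_pow_lt_succ_pow_of_log_div_log_lt (by omega) hP ?_
    rw [hd]
    push_cast
    exact Nat.lt_floor_add_one _
  simp only [happend]
  refine prod_mem_span_of_exists_hit _ d (fun S hS => ?_) univ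
  obtain ⟨g, hg⟩ := exists_forall_exists_eq_of_card_mul_pow_lt P f hfP S
    (by rwa [hS, Fintype.card_fin])
  refine ⟨fun j => (g j : ℝ) / P, fun m => ?_⟩
  obtain ⟨j, hj, hfg⟩ := hg m
  exact ⟨j, hj, by rw [hf, hfg]⟩
end

section
/- Let P ∈ ℕ₊, let G := {0, 1/P, 2/P, …, 1}, let N ∈ ℕ₊, and set t := ⌊ln N / ln((P+1)/P)⌋ + 1. Let v₁,…,v_N ∈ G^n with n ≥ t. Then there exist λ₁,…,λ_t ∈ G such that for every i ∈ {1,…,N}, Π_{j=1}^{t} (v_i(j) − λ_j) = 0; equivalently, every point v_i agrees with (λ₁,…,λ_t) in at least one of its first t coordinates. -/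
open Finset

/-- Some colour is missed by at most the fraction `P / (P + 1)` of a set coloured with `P + 1`
colours. -/
theorem exists_card_filter_ne_le {ι : Type*} {P : ℕ} (S : Finset ι) (f : ι → Fin (P + 1)) :
    ∃ c, (P + 1) * #{i ∈ S | f i ≠ c} ≤ P * #S := by
  obtain ⟨c, -, hc⟩ : ∃ c ∈ (univ : Finset (Fin (P + 1))),
      #S ≤ (P + 1) * #{i ∈ S | f i = c} := by
    apply exists_le_of_sum_le univ_nonempty
    rw [← mul_sum, ← card_eq_sum_card_fiberwise (fun _ _ => mem_coe.2 (mem_univ _))]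
    simp
  have hsplit := card_filter_add_card_filter_not (s := S) (fun i => f i = c)
  refine ⟨c, ?_⟩
  simp only [ne_eq]
  nlinarith

/-- Words of length `t` over `P + 1` letters: some word disagrees everywhere with at most the
fraction `(P / (P + 1)) ^ t` of a given family. -/
theorem exists_card_filter_forall_ne_le {ι : Type*} {P : ℕ} (t : ℕ) (S : Finset ι)
    (w : ι → Fin t → Fin (P + 1)) :
    ∃ c : Fin t → Fin (P + 1),
      (P + 1) ^ t * #{i ∈ S | ∀ j, w i j ≠ c j} ≤ P ^ t * #S := by
  induction t generalizing S with
  | zero => exact ⟨Fin.elim0, by simp⟩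
  | succ t ih =>
    obtain ⟨a, ha⟩ := exists_card_filter_ne_le S (fun i => w i 0)
    obtain ⟨c, hc⟩ := ih {i ∈ S | w i 0 ≠ a} (fun i j => w i j.succ)
    refine ⟨Fin.cons a c, ?_⟩
    simp only [Fin.forall_fin_succ, Fin.cons_zero, Fin.cons_succ]
    rw [filter_filter] at hc
    calc _ = (P + 1) * ((P + 1) ^ t * #{i ∈ S | w i 0 ≠ a ∧ ∀ j : Fin t, w i j.succ ≠ c j}) := by
          ring
      _ ≤ (P + 1) * (P ^ t * #{i ∈ S | w i 0 ≠ a}) := by gcongr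
      _ = P ^ t * ((P + 1) * #{i ∈ S | w i 0 ≠ a}) := by ring
      _ ≤ P ^ t * (P * #S) := by gcongr
      _ = P ^ (t + 1) * #S := by ring

theorem lt_pow_floor_log_div_log_add_one {x b : ℝ} (hb : 1 < b) :
    x < b ^ (⌊Real.log x / Real.log b⌋₊ + 1) := by
  apply Real.lt_pow_of_log_lt (by linarith)
  rw [← div_lt_iff₀ (Real.log_pos hb)]
  exact_mod_cast Nat.lt_floor_add_one _

/-- pigeonhole annihilation on the grid `G = {0, 1/P, …, 1}`.
With `t = ⌊ln N / ln((P+1)/P)⌋ + 1` and `n ≥ t`, for any `N` points `v₁,…,v_N ∈ G^n`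
there are grid values `λ₁,…,λ_t ∈ G` such that every point `v_i` agrees with
`(λ₁,…,λ_t)` in at least one of its first `t` coordinates,
i.e. `Π_{j=1}^t (v_i(j) − λ_j) = 0` for every `i`. -/
theorem statement11 (P : ℕ) (hP : 0 < P) (N : ℕ) (hN : 0 < N)
    (t : ℕ) (ht : t = Nat.floor (Real.log (N : ℝ) / Real.log (((P : ℝ) + 1) / P)) + 1)
    (n : ℕ) (hn : t ≤ n)
    (v : Fin N → Fin n → ℝ)
    (hv : ∀ i j, ∃ a : ℕ, a ≤ P ∧ v i j = (a : ℝ) / P) :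
    ∃ lam : Fin t → ℝ,
      (∀ j, ∃ a : ℕ, a ≤ P ∧ lam j = (a : ℝ) / P) ∧
      ∀ i, ∏ j : Fin t, (v i (Fin.castLE hn j) - lam j) = 0 := by
  have hP' : (0 : ℝ) < P := by exact_mod_cast hP
  have hlt : P ^ t * N < (P + 1) ^ t := by
    have h := lt_pow_floor_log_div_log_add_one (x := N) (b := ((P : ℝ) + 1) / P)
      (by rw [one_lt_div hP']; linarith)
    rw [← ht, div_pow, lt_div_iff₀ (by positivity), mul_comm] at h
    exact_mod_cast h
  choose a ha hva using hv
  obtain ⟨c, hc⟩ := exists_card_filter_forall_ne_le t univ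
    (fun i j => (⟨a i (Fin.castLE hn j), Nat.lt_succ_of_le (ha _ _)⟩ : Fin (P + 1)))
  refine ⟨fun j => ((c j : ℕ) : ℝ) / P, fun j => ⟨c j, Nat.le_of_lt_succ (c j).2, rfl⟩, fun i => ?_⟩
  rw [card_univ, Fintype.card_fin] at hc
  have hempty := Nat.lt_one_iff.1 (Nat.lt_of_mul_lt_mul_left ((hc.trans_lt hlt).trans_eq
    (mul_one _).symm))
  rw [card_eq_zero, filter_eq_empty_iff] at hempty
  have hi := hempty (mem_univ i)
  push Not at hi
  obtain ⟨j, hj⟩ := hi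
  refine prod_eq_zero (mem_univ j) ?_
  simp only [hva, ← hj, sub_self]
end

section
/- Let A be a real n × k matrix with full column rank, whose entries all lie in [0,1] and are each an integral multiple of some p > 0. Then for every u ∈ ℝ^k: ‖Au‖_∞ ≥ (p^k / k!) · ‖u‖_∞. In particular σ_min^∞(A) := min_{u ≠ 0} ‖Au‖_∞ / ‖u‖_∞ ≥ p^k · k^{−O(k)}. -/
open Finset

namespace Matrix

/-- A matrix over a field with linearly independent columns has an invertible square
submatrix consisting of some of its rows. -/
theorem exists_det_submatrix_ne_zero {m n K : Type*} [Fintype m] [Fintype n] [DecidableEq n]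
    [Field K] (A : Matrix m n K) (hA : LinearIndependent K A.col) :
    ∃ f : n → m, (A.submatrix f id).det ≠ 0 := by
  obtain ⟨κ, a, ha, hspan, hli⟩ := exists_linearIndependent' K A.row
  have : Finite κ := Finite.of_injective a ha
  have := Fintype.ofFinite κ
  have hcard : Fintype.card n = Fintype.card κ := by
    rw [← finrank_span_eq_card hli, hspan, ← rank_eq_finrank_span_row,
      rank_eq_finrank_span_cols, finrank_span_eq_card hA]
  let e := Fintype.equivOfCardEq hcard
  refine ⟨a ∘ e, ?_⟩
  have hrow : LinearIndependent K (A.submatrix (a ∘ e) id).row := hli.comp e e.injective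
  exact ((isUnit_iff_isUnit_det _).1 (linearIndependent_rows_iff_isUnit.1 hrow)).ne_zero

/-- A nonzero determinant of a matrix whose entries are integral multiples of `p > 0`
is at least `p ^ card n` in absolute value. -/
theorem pow_card_le_abs_det {n : Type*} [Fintype n] [DecidableEq n] (B : Matrix n n ℝ)
    {p : ℝ} (hp : 0 < p) (hB : ∀ i j, ∃ z : ℤ, B i j = z * p) (hdet : B.det ≠ 0) :
    p ^ Fintype.card n ≤ |B.det| := by
  choose Z hZ using hB
  have hBZ : B = p • (of Z).map (Int.castRingHom ℝ) := by
    ext i j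
    simp [hZ, mul_comm]
  have hdetZ : B.det = p ^ Fintype.card n * ((of Z).det : ℝ) := by
    rw [hBZ, det_smul, ← RingHom.mapMatrix_apply, ← RingHom.map_det, eq_intCast]
  have hne : (of Z).det ≠ 0 := fun h => hdet (by simp [hdetZ, h])
  have hone : (1 : ℝ) ≤ |((of Z).det : ℝ)| := mod_cast Int.one_le_abs hne
  rw [hdetZ, abs_mul, abs_of_pos (pow_pos hp _)]
  exact le_mul_of_one_le_right (pow_pos hp _).le hone

/-- If the entries of `B` are bounded by `1` in absolute value, then replacing a column by `b`
gives a determinant of absolute value at most `(card n)! * ‖b‖`. -/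
theorem abs_det_updateCol_le {n : Type*} [Fintype n] [DecidableEq n] (B : Matrix n n ℝ)
    (hB : ∀ i j, |B i j| ≤ 1) (j : n) (b : n → ℝ) :
    |(B.updateCol j b).det| ≤ (Fintype.card n).factorial * ‖b‖ := by
  rw [det_apply']
  have hterm (σ : Equiv.Perm n) :
      |((Equiv.Perm.sign σ : ℤ) : ℝ) * ∏ i, B.updateCol j b (σ i) i| ≤ ‖b‖ := by
    have hsign : |((Equiv.Perm.sign σ : ℤ) : ℝ)| = 1 := by
      rcases Int.units_eq_one_or (Equiv.Perm.sign σ) with h | h <;> simp [h]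
    rw [abs_mul, hsign, one_mul, Finset.abs_prod,
      ← Finset.mul_prod_erase _ _ (Finset.mem_univ j), updateCol_self]
    refine (mul_le_of_le_one_right (abs_nonneg _) ?_).trans (norm_le_pi_norm b (σ j))
    refine Finset.prod_le_one (fun _ _ => abs_nonneg _) fun i hi => ?_
    rw [updateCol_ne (Finset.ne_of_mem_erase hi)]
    exact hB _ _
  calc _ ≤ ∑ σ : Equiv.Perm n,
        |((Equiv.Perm.sign σ : ℤ) : ℝ) * ∏ i, B.updateCol j b (σ i) i| :=
        Finset.abs_sum_le_sum_abs _ _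
    _ ≤ ∑ _σ : Equiv.Perm n, ‖b‖ := Finset.sum_le_sum fun σ _ => hterm σ
    _ = _ := by simp [Fintype.card_perm]

end Matrix

/-- minimum `ℓ∞`-singular value of a full-column-rank matrix with
integral entries in `[0,1]`.  If the `n × k` real matrix `A` has linearly independent
columns, entries in `[0,1]`, each an integral multiple of `p > 0`, then
`‖Au‖_∞ ≥ (p^k / k!) · ‖u‖_∞` for every `u ∈ ℝ^k`. -/
theorem statement12 (n k : ℕ) (A : Matrix (Fin n) (Fin k) ℝ)
    (hrank : LinearIndependent ℝ (fun j : Fin k => fun i : Fin n => A i j))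
    (hrange : ∀ i j, A i j ∈ Set.Icc (0 : ℝ) 1)
    (p : ℝ) (hp : 0 < p)
    (hint : ∀ i j, ∃ m : ℤ, A i j = (m : ℝ) * p)
    (u : Fin k → ℝ) :
    p ^ k / (Nat.factorial k : ℝ) * ‖u‖ ≤ ‖A.mulVec u‖ := by
  obtain ⟨f, hf⟩ := A.exists_det_submatrix_ne_zero hrank
  have hdet := (A.submatrix f id).pow_card_le_abs_det hp (fun i j => hint (f i) j) hf
  have hb : ‖(A.submatrix f id).mulVec u‖ ≤ ‖A.mulVec u‖ :=
    (pi_norm_le_iff_of_nonneg (norm_nonneg _)).2 fun i => norm_le_pi_norm (A.mulVec u) (f i)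
  have hfac : (0 : ℝ) < k.factorial := by positivity
  rw [div_mul_eq_mul_div, div_le_iff₀ hfac, ← le_div_iff₀' (pow_pos hp k)]
  refine (pi_norm_le_iff_of_nonneg (by positivity)).2 fun j => ?_
  rw [le_div_iff₀' (pow_pos hp k), Real.norm_eq_abs]
  have hcramer : ((A.submatrix f id).updateCol j ((A.submatrix f id).mulVec u)).det =
      u j * (A.submatrix f id).det := by
    rw [← smul_eq_mul, ← Matrix.det_updateCol_sum]
    congr 2
    ext i
    simp [Matrix.mulVec, dotProduct, mul_comm]
  have hle := (A.submatrix f id).abs_det_updateCol_le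
    (fun i j => (abs_of_nonneg (hrange (f i) j).1).trans_le (hrange (f i) j).2) j
    ((A.submatrix f id).mulVec u)
  rw [hcramer, abs_mul] at hle
  rw [Fintype.card_fin] at hdet hle
  calc p ^ k * |u j| ≤ |(A.submatrix f id).det| * |u j| := by gcongr
    _ = |u j| * |(A.submatrix f id).det| := mul_comm _ _
    _ ≤ k.factorial * ‖(A.submatrix f id).mulVec u‖ := hle
    _ ≤ k.factorial * ‖A.mulVec u‖ := by gcongr
    _ = ‖A.mulVec u‖ * k.factorial := mul_comm _ _
end

section
/- Let 𝓜⁽¹⁾ and 𝓜⁽²⁾ be two RMMDPs over the same 𝒮, 𝒜, 𝒵 and horizon H with the same transition kernel T and initial distribution ν, each with a single latent context (M₁ = M₂ = 1), with reward models μ⁽¹⁾ and μ⁽²⁾. Let E be a set of length-H state–action sequences such that every state–action pair x appearing in some sequence of E satisfies |μ⁽¹⁾(x,z) − μ⁽²⁾(x,z)| ≤ δ for all z ∈ 𝒵. Then for every history-dependent policy π: Σ_{τ : x_{1:H} ∈ E} |P⁽¹⁾_π(τ) − P⁽²⁾_π(τ)| ≤ (sup_{π'} P⁽¹⁾_{π'}(x_{1:H}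 ∈ E)) · H · Z · δ, where Z = |𝒵|. -/
open Finset

/-- A probability distribution on a finite type. -/
def IsDist {X : Type*} [Fintype X] (p : X → ℝ) : Prop :=
  (∀ x, 0 ≤ p x) ∧ ∑ x, p x = 1

/-- A history-dependent policy: each history (past state-action-reward triples together
with the current state) is assigned a probability distribution over actions. -/
def IsPolicy {S A Z : Type*} [Fintype A]
    (π : List ((S × A) × Z) → S → A → ℝ) : Prop :=
  ∀ hist s, (∀ a, 0 ≤ π hist s a) ∧ ∑ a, π hist s a = 1

/-- A latent reward model: for each context and state-action pair, a distribution on rewards. -/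
def IsRewardModel {X Z : Type*} [Fintype Z] {M : ℕ}
    (μ : Fin M → X → Z → ℝ) : Prop :=
  ∀ m x, (∀ z, 0 ≤ μ m x z) ∧ ∑ z, μ m x z = 1

/-- The mixture moment `𝐌(x_I, z_I) = Σ_m w_m Π_{i ∈ I} μ_m(x_i, z_i)`. -/
def momentOn {X Z : Type*} {M d : ℕ} (w : Fin M → ℝ) (μ : Fin M → X → Z → ℝ)
    (x : Fin d → X) (z : Fin d → Z) (I : Finset (Fin d)) : ℝ :=
  ∑ m, w m * ∏ i ∈ I, μ m (x i) (z i)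

/-- Probability of a length-`H` trajectory `τ = ((s_t,a_t),r_t)_{t}` under a
history-dependent policy `π` in an RMMDP with transitions `T`, initial distribution `ν`,
mixing weights `w` and reward models `μ`. -/
noncomputable def trajProb {S A Z : Type*} (H : ℕ)
    (T : S × A → S → ℝ) (ν : S → ℝ)
    (π : List ((S × A) × Z) → S → A → ℝ)
    {M : ℕ} (w : Fin M → ℝ) (μ : Fin M → S × A → Z → ℝ)
    (τ : Fin H → (S × A) × Z) : ℝ :=
  (if h : 0 < H then ν ((τ ⟨0, h⟩).1.1) else 1)
    * (∏ t : Fin H, if h : (t : ℕ) + 1 < H then T (τ t).1 ((τ ⟨(t : ℕ) + 1, h⟩).1.1) else 1)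
    * (∏ t : Fin H, π ((List.ofFn τ).take t.val) (τ t).1.1 (τ t).1.2)
    * momentOn w μ (fun t => (τ t).1) (fun t => (τ t).2) Finset.univ

/-- `P_π(x_{1:H} ∈ E)`: total probability of trajectories whose state-action part lies in `E`. -/
noncomputable def eventProb {S A Z : Type*} [Fintype S] [Fintype A] [Fintype Z]
    [DecidableEq S] [DecidableEq A] (H : ℕ)
    (T : S × A → S → ℝ) (ν : S → ℝ)
    (π : List ((S × A) × Z) → S → A → ℝ)
    {M : ℕ} (w : Fin M → ℝ) (μ : Fin M → S × A → Z → ℝ)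
    (E : Finset (Fin H → S × A)) : ℝ :=
  ∑ τ : Fin H → (S × A) × Z,
    if (fun t => (τ t).1) ∈ E then trajProb H T ν π w μ τ else 0

/-- `sup_π P_π(x_{1:H} ∈ E)`, supremum over all history-dependent policies. -/
noncomputable def supEventProb {S A Z : Type*} [Fintype S] [Fintype A] [Fintype Z]
    [DecidableEq S] [DecidableEq A] (H : ℕ)
    (T : S × A → S → ℝ) (ν : S → ℝ)
    {M : ℕ} (w : Fin M → ℝ) (μ : Fin M → S × A → Z → ℝ)
    (E : Finset (Fin H → S × A)) : ℝ :=
  ⨆ π : {p : List ((S × A) × Z) → S → A → ℝ // IsPolicy p},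
    eventProb H T ν π.1 w μ E

section ControlledProcess

variable {S A Z : Type*}

/-- The part of the weight of a trajectory contributed by transitions and policy, for a
process started with state distribution `ρ` after the history `l`. -/
noncomputable def controlWeight (T : S × A → S → ℝ) (π : List ((S × A) × Z) → S → A → ℝ)
    (n : ℕ) (ρ : S → ℝ) (l : List ((S × A) × Z)) (τ : Fin n → (S × A) × Z) : ℝ :=
  (if h : 0 < n then ρ ((τ ⟨0, h⟩).1.1) else 1)
    * (∏ t : Fin n, if h : (t : ℕ) + 1 < n then T (τ t).1 ((τ ⟨(t : ℕ) + 1, h⟩).1.1) else 1)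
    * (∏ t : Fin n, π (l ++ (List.ofFn τ).take t.val) (τ t).1.1 (τ t).1.2)

theorem controlWeight_nonneg [Fintype A] {T : S × A → S → ℝ} (hT : ∀ x s, 0 ≤ T x s)
    {π : List ((S × A) × Z) → S → A → ℝ} (hπ : IsPolicy π) {n : ℕ} {ρ : S → ℝ}
    (hρ : ∀ s, 0 ≤ ρ s) (l : List ((S × A) × Z)) (τ : Fin n → (S × A) × Z) :
    0 ≤ controlWeight T π n ρ l τ := by
  refine mul_nonneg (mul_nonneg ?_ (prod_nonneg fun t _ => ?_))
    (prod_nonneg fun t _ => (hπ _ _).1 _)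
  · split_ifs
    exacts [hρ _, zero_le_one]
  · split_ifs
    exacts [hT _ _, zero_le_one]

theorem controlWeight_cons (T : S × A → S → ℝ) (π : List ((S × A) × Z) → S → A → ℝ)
    (n : ℕ) (ρ : S → ℝ) (l : List ((S × A) × Z)) (y : (S × A) × Z)
    (τ : Fin n → (S × A) × Z) :
    controlWeight T π (n + 1) ρ l (Fin.cons y τ) =
      ρ y.1.1 * π l y.1.1 y.1.2 * controlWeight T π n (T y.1) (l ++ [y]) τ := by
  have h0 : (⟨0, Nat.succ_pos n⟩ : Fin (n + 1)) = 0 := rfl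
  have hsucc : ∀ (k : ℕ) (h : k + 1 < n + 1),
      (Fin.cons y τ : Fin (n + 1) → (S × A) × Z) ⟨k + 1, h⟩ = τ ⟨k, Nat.lt_of_succ_lt_succ h⟩ :=
    fun _ _ => rfl
  simp only [controlWeight, Fin.prod_univ_succ, Fin.cons_succ, Fin.cons_zero, Fin.val_succ,
    List.ofFn_succ, List.take_succ_cons, h0, hsucc, Nat.succ_pos, dif_pos, Fin.val_zero,
    List.take_zero, List.append_nil, List.append_assoc, List.singleton_append,
    Nat.add_lt_add_iff_right]
  ring

variable [Fintype S] [Fintype A]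

/-- Expected terminal payoff `F` of the state-action sequence over the remaining `n` steps, when
rewards at time `t` are drawn from `κ t`. -/
noncomputable def expectedPayoff [Fintype Z] (T : S × A → S → ℝ)
    (π : List ((S × A) × Z) → S → A → ℝ) (κ : ℕ → S × A → Z → ℝ) (F : List (S × A) → ℝ) :
    ℕ → (S → ℝ) → List ((S × A) × Z) → ℝ
  | 0, _, l => F (l.map Prod.fst)
  | n + 1, ρ, l => ∑ s, ∑ a, ∑ z, ρ s * π l s a * κ l.length (s, a) z
      * expectedPayoff T π κ F n (T (s, a)) (l ++ [((s, a), z)])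

/-- Optimal value of the terminal payoff `F` over the remaining `n` steps. -/
noncomputable def optimalValue (T : S × A → S → ℝ) (F : List (S × A) → ℝ) :
    ℕ → (S → ℝ) → List (S × A) → ℝ
  | 0, _, h => F h
  | n + 1, ρ, h => ∑ s, ρ s * ⨆ a, optimalValue T F n (T (s, a)) (h ++ [(s, a)])

theorem sum_controlWeight_mul_prod [Fintype Z] (T : S × A → S → ℝ)
    (π : List ((S × A) × Z) → S → A → ℝ) (κ : ℕ → S × A → Z → ℝ) (F : List (S × A) → ℝ)
    (n : ℕ) (ρ : S → ℝ) (l : List ((S × A) × Z)) :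
    ∑ τ : Fin n → (S × A) × Z, controlWeight T π n ρ l τ
        * (∏ t : Fin n, κ (l.length + t) (τ t).1 (τ t).2)
        * F (l.map Prod.fst ++ List.ofFn fun t => (τ t).1)
      = expectedPayoff T π κ F n ρ l := by
  induction n generalizing ρ l with
  | zero => simp [controlWeight, expectedPayoff]
  | succ n ih =>
    rw [← (Fin.consEquiv fun _ : Fin (n + 1) => (S × A) × Z).sum_comp]
    simp only [Fintype.sum_prod_type, expectedPayoff, ← ih, mul_sum]
    refine sum_congr rfl fun s _ => sum_congr rfl fun a _ => sum_congr rfl fun z _ =>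
      sum_congr rfl fun τ _ => ?_
    have hcons : (Fin.consEquiv fun _ : Fin (n + 1) => (S × A) × Z) (((s, a), z), τ)
        = Fin.cons ((s, a), z) τ := rfl
    simp only [hcons, controlWeight_cons, Fin.prod_univ_succ, Fin.cons_zero,
      Fin.cons_succ, Fin.val_zero, Fin.val_succ, List.ofFn_succ, List.map_append, List.map_cons,
      List.map_nil, List.append_assoc, List.singleton_append, List.length_append,
      List.length_singleton, add_zero, add_assoc, add_comm 1]
    ring

theorem expectedPayoff_le_optimalValue [Fintype Z] {T : S × A → S → ℝ}
    (hT : ∀ x s, 0 ≤ T x s) {π : List ((S × A) × Z) → S → A → ℝ} (hπ : IsPolicy π)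
    {κ : ℕ → S × A → Z → ℝ} (hκ : ∀ t x, IsDist (κ t x)) (F : List (S × A) → ℝ) (n : ℕ)
    {ρ : S → ℝ} (hρ : ∀ s, 0 ≤ ρ s) (l : List ((S × A) × Z)) :
    expectedPayoff T π κ F n ρ l ≤ optimalValue T F n ρ (l.map Prod.fst) := by
  induction n generalizing ρ l with
  | zero => exact le_rfl
  | succ n ih =>
    refine sum_le_sum fun s _ => ?_
    set V := ⨆ a, optimalValue T F n (T (s, a)) (l.map Prod.fst ++ [(s, a)])
    calc ∑ a, ∑ z, ρ s * π l s a * κ l.length (s, a) z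
            * expectedPayoff T π κ F n (T (s, a)) (l ++ [((s, a), z)])
        ≤ ∑ a, ∑ z, ρ s * π l s a * κ l.length (s, a) z * V := by
          refine sum_le_sum fun a _ => sum_le_sum fun z _ =>
            mul_le_mul_of_nonneg_left ?_ (mul_nonneg (mul_nonneg (hρ s) ((hπ l s).1 a))
              ((hκ _ _).1 z))
          refine (ih (hT _) _).trans ?_
          rw [List.map_append]
          exact le_ciSup (f := fun a => optimalValue T F n (T (s, a)) (l.map Prod.fst ++ [(s, a)]))
            (Set.finite_range _).bddAbove a
      _ = ρ s * V := by
          simp only [← sum_mul, ← mul_sum, (hκ _ _).2, (hπ l s).2, mul_one]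

/-- The optimal value is attained by a policy that ignores the rewards. -/
theorem exists_policy_expectedPayoff_eq [Fintype Z] [Nonempty A] (T : S × A → S → ℝ)
    (F : List (S × A) → ℝ) (H : ℕ) (ν : S → ℝ) :
    ∃ π : List ((S × A) × Z) → S → A → ℝ, IsPolicy π ∧
      ∀ κ : ℕ → S × A → Z → ℝ, (∀ t x, IsDist (κ t x)) →
        expectedPayoff T π κ F H ν [] = optimalValue T F H ν [] := by
  classical
  have hmax : ∀ (n : ℕ) (h : List (S × A)) (s : S), ∃ b,
      optimalValue T F n (T (s, b)) (h ++ [(s, b)])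
        = ⨆ a, optimalValue T F n (T (s, a)) (h ++ [(s, a)]) :=
    fun n h s => exists_eq_ciSup_of_finite
  choose g hg using hmax
  refine ⟨fun l s a => if a = g (H - 1 - l.length) (l.map Prod.fst) s then 1 else 0,
    fun l s => ⟨fun a => by positivity, by simp⟩, fun κ hκ => ?_⟩
  suffices hmain : ∀ (n : ℕ) (ρ : S → ℝ) (l : List ((S × A) × Z)), n + l.length = H →
      expectedPayoff T (fun l s a => if a = g (H - 1 - l.length) (l.map Prod.fst) s then 1 else 0)
        κ F n ρ l = optimalValue T F n ρ (l.map Prod.fst) from hmain H ν [] rfl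
  intro n
  induction n with
  | zero => exact fun _ _ _ => rfl
  | succ n ih =>
    intro ρ l hl
    have hn : H - 1 - l.length = n := by omega
    refine sum_congr rfl fun s _ => ?_
    rw [← hg n (l.map Prod.fst) s]
    have hstep : ∀ a z, expectedPayoff T
        (fun l s a => if a = g (H - 1 - l.length) (l.map Prod.fst) s then 1 else 0)
        κ F n (T (s, a)) (l ++ [((s, a), z)])
          = optimalValue T F n (T (s, a)) (l.map Prod.fst ++ [(s, a)]) := fun a z => by
      rw [ih _ _ (by simp; omega), List.map_append]
      rfl
    simp only [hstep, ← sum_mul, ← mul_sum, (hκ _ _).2, hn]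
    simp

end ControlledProcess

section RewardReplacement

variable {X Z : Type*} [Fintype Z]

/-- Rewards follow `μ₁` before time `t`, are uniform at time `t` and follow `μ₂` afterwards. -/
noncomputable def hybridReward (μ₁ μ₂ : X → Z → ℝ) (t i : ℕ) (x : X) (z : Z) : ℝ :=
  if i < t then μ₁ x z else if i = t then (Fintype.card Z : ℝ)⁻¹ else μ₂ x z

theorem isDist_hybridReward [Nonempty Z] {μ₁ μ₂ : X → Z → ℝ} (hμ₁ : ∀ x, IsDist (μ₁ x))
    (hμ₂ : ∀ x, IsDist (μ₂ x)) (t i : ℕ) (x : X) : IsDist (hybridReward μ₁ μ₂ t i x) := by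
  unfold hybridReward
  split_ifs
  · exact hμ₁ x
  · exact ⟨fun _ => by positivity, by simp⟩
  · exact hμ₂ x

theorem abs_prod_sub_prod_le_sum_hybridReward [Nonempty Z] {μ₁ μ₂ : X → Z → ℝ}
    (hμ₁ : ∀ x z, 0 ≤ μ₁ x z) (hμ₂ : ∀ x z, 0 ≤ μ₂ x z) {δ : ℝ} {n : ℕ} (x : Fin n → X)
    (z : Fin n → Z) (hδ : ∀ t, |μ₁ (x t) (z t) - μ₂ (x t) (z t)| ≤ δ) :
    |∏ t, μ₁ (x t) (z t) - ∏ t, μ₂ (x t) (z t)|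
      ≤ ∑ t : Fin n, Fintype.card Z * δ * ∏ i : Fin n, hybridReward μ₁ μ₂ t i (x i) (z i) := by
  have hprod : ∀ t : Fin n, Fintype.card Z * δ * ∏ i : Fin n, hybridReward μ₁ μ₂ t i (x i) (z i)
      = δ * (∏ i with i < t, μ₁ (x i) (z i)) * ∏ i with t < i, μ₂ (x i) (z i) := fun t => by
    have hgt : ({i | ¬ i < t} : Finset (Fin n)) = insert t ({i | t < i} : Finset (Fin n)) := by
      ext i
      simp [le_iff_eq_or_lt, eq_comm]
    have hcard : (Fintype.card Z : ℝ) ≠ 0 := by simp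
    rw [← prod_filter_mul_prod_filter_not univ (fun i => i < t), hgt, prod_insert (by simp)]
    have h1 : ∏ i with i < t, hybridReward μ₁ μ₂ t i (x i) (z i)
        = ∏ i with i < t, μ₁ (x i) (z i) :=
      prod_congr rfl fun i hi => if_pos (mem_filter.1 hi).2
    have h2 : ∏ i with t < i, hybridReward μ₁ μ₂ t i (x i) (z i)
        = ∏ i with t < i, μ₂ (x i) (z i) :=
      prod_congr rfl fun i hi => by
        have hi : (t : ℕ) < i := (mem_filter.1 hi).2
        rw [hybridReward, if_neg hi.not_gt, if_neg hi.ne']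
    have h3 : hybridReward μ₁ μ₂ t t (x t) (z t) = (Fintype.card Z : ℝ)⁻¹ := by
      simp [hybridReward]
    rw [h1, h2, h3]
    field_simp
  have htel := prod_add_ordered univ (fun t => μ₂ (x t) (z t))
    (fun t => μ₁ (x t) (z t) - μ₂ (x t) (z t))
  simp only [add_sub_cancel] at htel
  rw [htel, add_sub_cancel_left]
  refine (abs_sum_le_sum_abs _ _).trans (sum_le_sum fun t _ => ?_)
  have hp₁ : 0 ≤ ∏ i with i < t, μ₁ (x i) (z i) := prod_nonneg fun _ _ => hμ₁ _ _
  have hp₂ : 0 ≤ ∏ i with t < i, μ₂ (x i) (z i) := prod_nonneg fun _ _ => hμ₂ _ _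
  rw [hprod, abs_mul, abs_mul, abs_of_nonneg hp₁, abs_of_nonneg hp₂]
  gcongr
  exact hδ t

end RewardReplacement

section SingleContext

variable {S A Z : Type*}

theorem trajProb_single (H : ℕ) (T : S × A → S → ℝ) (ν : S → ℝ)
    (π : List ((S × A) × Z) → S → A → ℝ) (μ : S × A → Z → ℝ) (τ : Fin H → (S × A) × Z) :
    trajProb H T ν π (fun _ : Fin 1 => (1 : ℝ)) (fun _ => μ) τ
      = controlWeight T π H ν [] τ * ∏ t, μ (τ t).1 (τ t).2 := by
  simp [trajProb, controlWeight, momentOn]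

variable [Fintype S] [Fintype A] [Fintype Z] [DecidableEq S] [DecidableEq A]

/-- Indicator of the lists that enumerate a sequence of `E`. -/
noncomputable def listIndicator {H : ℕ} (E : Finset (Fin H → S × A)) (L : List (S × A)) : ℝ :=
  if L ∈ E.image List.ofFn then 1 else 0

theorem sum_ite_mem_eq_expectedPayoff (H : ℕ) (T : S × A → S → ℝ) (ν : S → ℝ)
    (π : List ((S × A) × Z) → S → A → ℝ) (κ : ℕ → S × A → Z → ℝ)
    (E : Finset (Fin H → S × A)) :
    ∑ τ : Fin H → (S × A) × Z, (if (fun t => (τ t).1) ∈ E then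
        controlWeight T π H ν [] τ * ∏ t : Fin H, κ t (τ t).1 (τ t).2 else 0)
      = expectedPayoff T π κ (listIndicator E) H ν [] := by
  rw [← sum_controlWeight_mul_prod]
  refine sum_congr rfl fun τ _ => ?_
  simp [listIndicator, List.ofFn_injective.eq_iff]

theorem eventProb_single (H : ℕ) (T : S × A → S → ℝ) (ν : S → ℝ)
    (π : List ((S × A) × Z) → S → A → ℝ) (μ : S × A → Z → ℝ) (E : Finset (Fin H → S × A)) :
    eventProb H T ν π (fun _ : Fin 1 => (1 : ℝ)) (fun _ => μ) E
      = expectedPayoff T π (fun _ => μ) (listIndicator E) H ν [] := by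
  rw [← sum_ite_mem_eq_expectedPayoff]
  simp only [eventProb, trajProb_single]

theorem optimalValue_le_supEventProb [Nonempty A] (H : ℕ) {T : S × A → S → ℝ} {ν : S → ℝ}
    (hT : ∀ x s, 0 ≤ T x s) (hν : ∀ s, 0 ≤ ν s) {μ : S × A → Z → ℝ}
    (hμ : ∀ x, IsDist (μ x)) (E : Finset (Fin H → S × A)) :
    optimalValue T (listIndicator E) H ν []
      ≤ supEventProb H T ν (fun _ : Fin 1 => (1 : ℝ)) (fun _ => μ) E := by
  obtain ⟨π, hπ, hopt⟩ := exists_policy_expectedPayoff_eq (Z := Z) T (listIndicator E) H ν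
  rw [← hopt (fun _ => μ) fun _ => hμ, ← eventProb_single]
  refine le_ciSup (f := fun π : {p : List ((S × A) × Z) → S → A → ℝ // IsPolicy p} =>
    eventProb H T ν π.1 (fun _ : Fin 1 => (1 : ℝ)) (fun _ => μ) E)
    ⟨optimalValue T (listIndicator E) H ν [], ?_⟩ ⟨π, hπ⟩
  rintro _ ⟨π', rfl⟩
  simp only [eventProb_single]
  exact expectedPayoff_le_optimalValue hT π'.2 (fun _ => hμ) _ _ hν []

end SingleContext

/-- base case `M₁ = M₂ = 1` of the total-variation bound.
Two single-context RMMDPs sharing `T, ν`, whose reward models are `δ`-close at every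
state-action pair appearing in a sequence of `E`, have trajectory distributions that are
`sup_{π'} P⁽¹⁾_{π'}(x_{1:H} ∈ E) · H · Z · δ`-close on `E`, for every history-dependent
policy `π`. -/
theorem statement15 {S A Z : Type*} [Fintype S] [Fintype A] [Fintype Z]
    [DecidableEq S] [DecidableEq A]
    (H : ℕ) (T : S × A → S → ℝ) (ν : S → ℝ)
    (hT : ∀ x, IsDist (T x)) (hν : IsDist ν)
    (μ₁ μ₂ : S × A → Z → ℝ)
    (hμ₁ : ∀ x, (∀ z, 0 ≤ μ₁ x z) ∧ ∑ z, μ₁ x z = 1)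
    (hμ₂ : ∀ x, (∀ z, 0 ≤ μ₂ x z) ∧ ∑ z, μ₂ x z = 1)
    (δ : ℝ)
    (E : Finset (Fin H → S × A))
    (hE : ∀ x ∈ E, ∀ (t : Fin H) (z : Z), |μ₁ (x t) z - μ₂ (x t) z| ≤ δ)
    (π : List ((S × A) × Z) → S → A → ℝ) (hπ : IsPolicy π) :
    ∑ τ : Fin H → (S × A) × Z,
        (if (fun t => (τ t).1) ∈ E then
          |trajProb H T ν π (fun _ : Fin 1 => (1 : ℝ)) (fun _ => μ₁) τ
            - trajProb H T ν π (fun _ : Fin 1 => (1 : ℝ)) (fun _ => μ₂) τ| else 0)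
      ≤ supEventProb H T ν (fun _ : Fin 1 => (1 : ℝ)) (fun _ => μ₁) E
          * ((H : ℝ) * Fintype.card Z) * δ := by
  rcases E.eq_empty_or_nonempty with rfl | ⟨x₀, hx₀⟩
  · simp [supEventProb, eventProb]
  rcases H.eq_zero_or_pos with rfl | hH
  · simp [trajProb_single]
  have hZ : Nonempty Z := by
    by_contra hempty
    rw [not_nonempty_iff] at hempty
    simpa using (hμ₁ (x₀ ⟨0, hH⟩)).2
  have hA : Nonempty A := ⟨(x₀ ⟨0, hH⟩).2⟩
  have hδ : 0 ≤ δ := (abs_nonneg _).trans (hE x₀ hx₀ ⟨0, hH⟩ hZ.some)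
  have hT' : ∀ x s, 0 ≤ T x s := fun x => (hT x).1
  calc _ ≤ ∑ τ : Fin H → (S × A) × Z, ∑ t : Fin H, Fintype.card Z * δ *
          (if (fun t => (τ t).1) ∈ E then controlWeight T π H ν [] τ *
            ∏ i : Fin H, hybridReward μ₁ μ₂ t i (τ i).1 (τ i).2 else 0) := by
        refine sum_le_sum fun τ _ => ?_
        split_ifs with hτ
        · have hw := controlWeight_nonneg hT' hπ hν.1 [] τ
          rw [trajProb_single, trajProb_single, ← mul_sub, abs_mul, abs_of_nonneg hw]
          refine (mul_le_mul_of_nonneg_left (abs_prod_sub_prod_le_sum_hybridReward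
            (fun x => (hμ₁ x).1) (fun x => (hμ₂ x).1) (fun t => (τ t).1) (fun t => (τ t).2)
            fun t => hE _ hτ t _) hw).trans_eq ?_
          rw [mul_sum]
          exact sum_congr rfl fun t _ => by ring
        · simp
    _ = ∑ t : Fin H, Fintype.card Z * δ *
          expectedPayoff T π (hybridReward μ₁ μ₂ t) (listIndicator E) H ν [] := by
        rw [sum_comm]
        simp only [← mul_sum, sum_ite_mem_eq_expectedPayoff]
    _ ≤ ∑ _t : Fin H, Fintype.card Z * δ *
          supEventProb H T ν (fun _ : Fin 1 => (1 : ℝ)) (fun _ => μ₁) E := by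
        refine sum_le_sum fun t _ => mul_le_mul_of_nonneg_left ?_ (by positivity)
        exact (expectedPayoff_le_optimalValue hT' hπ (isDist_hybridReward hμ₁ hμ₂ t) _ H
          hν.1 []).trans (optimalValue_le_supEventProb H hT' hν.1 hμ₁ E)
    _ = _ := by
        rw [sum_const, card_univ, Fintype.card_fin, nsmul_eq_mul]
        ring
end

section
/- Let 𝓜⁽¹⁾ and 𝓜⁽²⁾ be two RMMDPs over the same 𝒮, 𝒜, 𝒵 and horizon H with the same transition kernel T and initial distribution ν, with M₁ and M₂ latent contexts respectively, and suppose H ≤ M₁ + M₂ − 1. Let E be a set of length-H state–action sequences such that for every x_{1:H} ∈ E and every r ∈ 𝒵^H, the full degree-H moments match up to δ: |𝐌⁽¹⁾(x_{1:H}, r_{1:H}) − 𝐌⁽²⁾(x_{1:H}, r_{1:H})| ≤ δ. Then for every history-dependent policy π: Σ_{τ : x_{1:H} ∈ E} |P⁽¹⁾_π(τ) − P⁽²⁾_π(τ)| ≤ (sup_{π'} P⁽¹⁾_{π'}(x_{1:H} ∈ E)) · Z^H · δ, where Z = |𝒵|. -/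
open Finset

/-- The part of the trajectory probability that does not involve the reward models. -/
noncomputable def trajWeight {S A Z : Type*} (H : ℕ)
    (T : S × A → S → ℝ) (ν : S → ℝ) (π : List ((S × A) × Z) → S → A → ℝ)
    (τ : Fin H → (S × A) × Z) : ℝ :=
  (if h : 0 < H then ν ((τ ⟨0, h⟩).1.1) else 1)
    * (∏ t : Fin H, if h : (t : ℕ) + 1 < H then T (τ t).1 ((τ ⟨(t : ℕ) + 1, h⟩).1.1) else 1)
    * (∏ t : Fin H, π ((List.ofFn τ).take t.val) (τ t).1.1 (τ t).1.2)

/-- The policy that ignores the observed rewards and feeds the fixed sequence `r` to `π`. -/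
def fixRewards {S A Z : Type*} {H : ℕ} (π : List ((S × A) × Z) → S → A → ℝ) (r : Fin H → Z) :
    List ((S × A) × Z) → S → A → ℝ :=
  fun hist => π (hist.mapIdx fun i p => (p.1, if h : i < H then r ⟨i, h⟩ else p.2))

section

variable {S A Z : Type*} {H : ℕ} {T : S × A → S → ℝ} {ν : S → ℝ}
  {π : List ((S × A) × Z) → S → A → ℝ}

theorem trajProb_eq_trajWeight_mul {M : ℕ} (w : Fin M → ℝ) (μ : Fin M → S × A → Z → ℝ)
    (τ : Fin H → (S × A) × Z) :
    trajProb H T ν π w μ τ = trajWeight H T ν π τ *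
      momentOn w μ (fun t => (τ t).1) (fun t => (τ t).2) Finset.univ :=
  rfl

theorem isPolicy_fixRewards [Fintype A] (hπ : IsPolicy π) (r : Fin H → Z) :
    IsPolicy (fixRewards π r) :=
  fun _ s => hπ _ s

theorem trajWeight_fixRewards (r r' : Fin H → Z) (x : Fin H → S × A) :
    trajWeight H T ν (fixRewards π r) (fun t => (x t, r' t)) =
      trajWeight H T ν π (fun t => (x t, r t)) := by
  unfold trajWeight fixRewards
  congr 1
  refine Finset.prod_congr rfl fun t _ => ?_
  refine congrArg (fun l => π l (x t).1 (x t).2) ?_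
  refine List.ext_getElem (by simp) fun i h₁ h₂ => ?_
  have hi : i < H := by
    simp only [List.length_take, List.length_ofFn] at h₂
    omega
  simp [hi]

theorem initial_mul_transition_nonneg [Fintype S] (hT : ∀ x, IsDist (T x)) (hν : IsDist ν)
    (τ : Fin H → (S × A) × Z) :
    0 ≤ (if h : 0 < H then ν ((τ ⟨0, h⟩).1.1) else 1) *
      ∏ t : Fin H, if h : (t : ℕ) + 1 < H then T (τ t).1 ((τ ⟨(t : ℕ) + 1, h⟩).1.1) else 1 := by
  refine mul_nonneg ?_ (Finset.prod_nonneg fun t _ => ?_)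
  · split_ifs
    · exact hν.1 _
    · exact zero_le_one
  · split_ifs
    · exact (hT _).1 _
    · exact zero_le_one

theorem trajWeight_nonneg [Fintype S] [Fintype A] (hT : ∀ x, IsDist (T x)) (hν : IsDist ν)
    (hπ : IsPolicy π) (τ : Fin H → (S × A) × Z) : 0 ≤ trajWeight H T ν π τ :=
  mul_nonneg (initial_mul_transition_nonneg hT hν τ)
    (Finset.prod_nonneg fun _ _ => (hπ _ _).1 _)

theorem trajWeight_le [Fintype S] [Fintype A] (hT : ∀ x, IsDist (T x)) (hν : IsDist ν)
    (hπ : IsPolicy π) (τ : Fin H → (S × A) × Z) :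
    trajWeight H T ν π τ ≤ trajWeight H T ν (fun _ _ _ => 1) τ := by
  refine mul_le_mul_of_nonneg_left ?_ (initial_mul_transition_nonneg hT hν τ)
  refine Finset.prod_le_prod (fun _ _ => (hπ _ _).1 _) fun t _ => ?_
  rw [← (hπ ((List.ofFn τ).take t.val) (τ t).1.1).2]
  exact Finset.single_le_sum (fun a _ => (hπ _ _).1 a) (Finset.mem_univ _)

theorem momentOn_nonneg {X : Type*} [Fintype Z] {M : ℕ} {w : Fin M → ℝ} {μ : Fin M → X → Z → ℝ}
    (hw : IsDist w) (hμ : IsRewardModel μ) {d : ℕ} (x : Fin d → X) (z : Fin d → Z)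
    (I : Finset (Fin d)) : 0 ≤ momentOn w μ x z I :=
  Finset.sum_nonneg fun m _ =>
    mul_nonneg (hw.1 m) (Finset.prod_nonneg fun _ _ => (hμ m _).1 _)

theorem sum_momentOn_univ {X : Type*} [Fintype Z] {M : ℕ} {w : Fin M → ℝ} {μ : Fin M → X → Z → ℝ}
    (hw : IsDist w) (hμ : IsRewardModel μ) {d : ℕ} (x : Fin d → X) :
    ∑ z : Fin d → Z, momentOn w μ x z Finset.univ = 1 := by
  unfold momentOn
  rw [Finset.sum_comm, ← hw.2]
  refine Finset.sum_congr rfl fun m _ => ?_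
  have h := Finset.prod_univ_sum (fun _ : Fin d => (Finset.univ : Finset Z))
    fun i z => μ m (x i) z
  rw [Fintype.piFinset_univ] at h
  rw [← Finset.mul_sum, ← h]
  simp [(hμ m _).2]

theorem sum_trajectories [Fintype S] [Fintype A] [Fintype Z] (f : (Fin H → (S × A) × Z) → ℝ) :
    ∑ τ, f τ = ∑ r : Fin H → Z, ∑ x : Fin H → S × A, f (fun t => (x t, r t)) := by
  rw [← Fintype.sum_prod_type_right']
  exact Fintype.sum_equiv (Equiv.arrowProdEquivProdArrow (Fin H) (fun _ => S × A) fun _ => Z)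
    _ _ fun _ => rfl

variable [Fintype S] [Fintype A] [Fintype Z] [DecidableEq S] [DecidableEq A]

theorem eventProb_fixRewards {M : ℕ} {w : Fin M → ℝ} {μ : Fin M → S × A → Z → ℝ}
    (hw : IsDist w) (hμ : IsRewardModel μ) (r : Fin H → Z) (E : Finset (Fin H → S × A)) :
    eventProb H T ν (fixRewards π r) w μ E =
      ∑ x : Fin H → S × A, if x ∈ E then trajWeight H T ν π (fun t => (x t, r t)) else 0 := by
  unfold eventProb
  rw [sum_trajectories, Finset.sum_comm]
  refine Finset.sum_congr rfl fun x _ => ?_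
  by_cases hx : x ∈ E
  · simp only [hx, if_true, trajProb_eq_trajWeight_mul, trajWeight_fixRewards]
    rw [← Finset.mul_sum, sum_momentOn_univ hw hμ, mul_one]
  · simp [hx]

theorem eventProb_le_supEventProb (hT : ∀ x, IsDist (T x)) (hν : IsDist ν)
    {M : ℕ} {w : Fin M → ℝ} {μ : Fin M → S × A → Z → ℝ}
    (hw : IsDist w) (hμ : IsRewardModel μ) (hπ : IsPolicy π) (E : Finset (Fin H → S × A)) :
    eventProb H T ν π w μ E ≤ supEventProb H T ν w μ E := by
  refine le_ciSup (f := fun p : {p : List ((S × A) × Z) → S → A → ℝ // IsPolicy p} =>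
    eventProb H T ν p.1 w μ E) ⟨eventProb H T ν (fun _ _ _ => 1) w μ E, ?_⟩ ⟨π, hπ⟩
  rintro _ ⟨p, rfl⟩
  refine Finset.sum_le_sum fun τ _ => ?_
  split_ifs
  · exact mul_le_mul_of_nonneg_right (trajWeight_le hT hν p.2 τ) (momentOn_nonneg hw hμ _ _ _)
  · exact le_rfl

theorem sum_trajWeight_le (hT : ∀ x, IsDist (T x)) (hν : IsDist ν)
    {M : ℕ} {w : Fin M → ℝ} {μ : Fin M → S × A → Z → ℝ}
    (hw : IsDist w) (hμ : IsRewardModel μ) (hπ : IsPolicy π) (E : Finset (Fin H → S × A)) :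
    ∑ τ : Fin H → (S × A) × Z, (if (fun t => (τ t).1) ∈ E then trajWeight H T ν π τ else 0) ≤
      supEventProb H T ν w μ E * (Fintype.card Z : ℝ) ^ H := by
  rw [sum_trajectories]
  refine (Finset.sum_le_card_nsmul _ _ (supEventProb H T ν w μ E) fun r _ => ?_).trans_eq ?_
  · rw [← eventProb_fixRewards hw hμ r E]
    exact eventProb_le_supEventProb hT hν hw hμ (isPolicy_fixRewards hπ r) E
  · simp [mul_comm]

end

/-- short-horizon base case `H ≤ M₁ + M₂ − 1` of the total-variation
bound.  If for every sequence in `E` the full degree-`H` moments of the two RMMDPs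
(sharing `T, ν`) match up to `δ`, then for every history-dependent policy `π` the
trajectory distributions restricted to `E` are
`sup_{π'} P⁽¹⁾_{π'}(x_{1:H} ∈ E) · Z^H · δ`-close. -/
theorem statement16 {S A Z : Type*} [Fintype S] [Fintype A] [Fintype Z]
    [DecidableEq S] [DecidableEq A]
    (H : ℕ) (T : S × A → S → ℝ) (ν : S → ℝ)
    (hT : ∀ x, IsDist (T x)) (hν : IsDist ν)
    {M₁ M₂ : ℕ}
    (w₁ : Fin M₁ → ℝ) (μ₁ : Fin M₁ → S × A → Z → ℝ)
    (w₂ : Fin M₂ → ℝ) (μ₂ : Fin M₂ → S × A → Z → ℝ)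
    (hw₁ : IsDist w₁) (hw₂ : IsDist w₂)
    (hμ₁ : IsRewardModel μ₁) (hμ₂ : IsRewardModel μ₂)
    (hH : H ≤ M₁ + M₂ - 1)
    (δ : ℝ)
    (E : Finset (Fin H → S × A))
    (hE : ∀ x ∈ E, ∀ r : Fin H → Z,
      |momentOn w₁ μ₁ x r Finset.univ - momentOn w₂ μ₂ x r Finset.univ| ≤ δ)
    (π : List ((S × A) × Z) → S → A → ℝ) (hπ : IsPolicy π) :
    ∑ τ : Fin H → (S × A) × Z,
        (if (fun t => (τ t).1) ∈ E then
          |trajProb H T ν π w₁ μ₁ τ - trajProb H T ν π w₂ μ₂ τ| else 0)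
      ≤ supEventProb H T ν w₁ μ₁ E * (Fintype.card Z : ℝ) ^ H * δ := by
  have bound : ∑ τ : Fin H → (S × A) × Z,
      (if (fun t => (τ t).1) ∈ E then
        |trajProb H T ν π w₁ μ₁ τ - trajProb H T ν π w₂ μ₂ τ| else 0) ≤
      (∑ τ : Fin H → (S × A) × Z,
        if (fun t => (τ t).1) ∈ E then trajWeight H T ν π τ else 0) * δ := by
    rw [Finset.sum_mul]
    refine Finset.sum_le_sum fun τ _ => ?_
    split_ifs with hτ
    · have hc := trajWeight_nonneg hT hν hπ τ
      rw [trajProb_eq_trajWeight_mul, trajProb_eq_trajWeight_mul, ← mul_sub, abs_mul,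
        abs_of_nonneg hc]
      exact mul_le_mul_of_nonneg_left (hE _ hτ _) hc
    · simp
  rcases le_or_gt 0 δ with hδ | hδ
  · exact bound.trans
      (mul_le_mul_of_nonneg_right (sum_trajWeight_le hT hν hw₁ hμ₁ hπ E) hδ)
  rcases E.eq_empty_or_nonempty with rfl | ⟨x, hx⟩
  · simp [supEventProb, eventProb]
  rcases isEmpty_or_nonempty (Fin H → Z) with hr | ⟨⟨r⟩⟩
  · have hcard : (Fintype.card Z : ℝ) ^ H = 0 := by
      have h : Fintype.card (Fin H → Z) = 0 := Fintype.card_eq_zero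
      rw [Fintype.card_fun, Fintype.card_fin] at h
      exact_mod_cast h
    rw [hcard, sum_trajectories]
    simp
  · exact absurd ((abs_nonneg _).trans (hE x hx r)) hδ.not_ge
end
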